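/- Let m > 0, ν ∈ (0, 1/m], λ ∈ [0, (1 + νm)/2), and let c > 0 satisfy (1 − 2λ)·J_ν(2c/m) + 2c·J′_ν(2c/m) = 0 with 2c/m ∈ (0, j_ν). Let f be an absolutely continuous function on [0, 1] with f(0) = 0 and f′(x)/x ∈ L¹[0, 1]. Then ((1 − ν²m²)/4)·∫₀¹ |f(x)|/x² dx + c²·∫₀¹ |f(x)|/x^{2−m} dx ≤ ((1 + νm)/2 − λ²)·∫₀¹ |f′(x)|/x dx + (λ² − λ)·∫₀¹ |f′(x)| dx. -/

import Mathlib

open MeasureTheory Real Set Filter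

/-- Bessel function of the first kind of real order `ν`, defined for `x > 0` by its series. -/
noncomputable def besselJ (ν x : ℝ) : ℝ :=
  ∑' k : ℕ, (-1 : ℝ) ^ k * x ^ (2 * (k : ℝ) + ν) /
    (2 ^ (2 * (k : ℝ) + ν) * (Nat.factorial k : ℝ) * Real.Gamma ((k : ℝ) + 1 + ν))


/-- The coefficients of the entire function `besselE μ`. -/
noncomputable def besselECoeff (μ : ℝ) (k : ℕ) : ℝ :=
  (-1) ^ k / ((Nat.factorial k : ℝ) * Real.Gamma ((k : ℝ) + 1 + μ))

/-- The entire part of the Bessel function: `J_μ(x) = (x / 2) ^ μ * besselE μ (x ^ 2 / 4)`. -/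
noncomputable def besselE (μ u : ℝ) : ℝ :=
  ∑' k : ℕ, besselECoeff μ k * u ^ k

lemma Gamma_le_Gamma_nat_add {μ : ℝ} (hμ : 0 ≤ μ) (k : ℕ) :
    Real.Gamma (1 + μ) ≤ Real.Gamma ((k : ℝ) + 1 + μ) := by
  induction k with
  | zero => simp
  | succ k ih =>
    have hpos : (0 : ℝ) < (k : ℝ) + 1 + μ := by positivity
    have h := Real.Gamma_add_one hpos.ne'
    have hG := Real.Gamma_pos_of_pos hpos
    have e : ((k + 1 : ℕ) : ℝ) + 1 + μ = (k : ℝ) + 1 + μ + 1 := by push_cast; ring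
    have hk : (0 : ℝ) ≤ k := k.cast_nonneg
    rw [e, h]
    nlinarith

lemma abs_besselECoeff_le {μ : ℝ} (hμ : 0 ≤ μ) (k : ℕ) :
    |besselECoeff μ k| ≤ (Real.Gamma (1 + μ))⁻¹ / (Nat.factorial k : ℝ) := by
  have h0 : 0 < Real.Gamma (1 + μ) := Real.Gamma_pos_of_pos (by linarith)
  have h1 := Gamma_le_Gamma_nat_add hμ k
  have hf : (0 : ℝ) < Nat.factorial k := by exact_mod_cast Nat.factorial_pos k
  rw [besselECoeff, abs_div, abs_pow, abs_neg, abs_one, one_pow,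
    abs_of_pos (mul_pos hf (h0.trans_le h1)), div_eq_mul_inv, one_mul, mul_inv, div_eq_mul_inv,
    mul_comm]
  gcongr

lemma besselECoeff_succ (μ : ℝ) (k : ℕ) :
    besselECoeff μ (k + 1) * ((k : ℝ) + 1) = -besselECoeff (μ + 1) k := by
  have e : ((k + 1 : ℕ) : ℝ) + 1 + μ = (k : ℝ) + 1 + (μ + 1) := by push_cast; ring
  have hf : (Nat.factorial k : ℝ) ≠ 0 := by exact_mod_cast Nat.factorial_ne_zero k
  have hk : (k : ℝ) + 1 ≠ 0 := by positivity
  rw [besselECoeff, besselECoeff, e, Nat.factorial_succ, pow_succ]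
  push_cast
  generalize Real.Gamma ((k : ℝ) + 1 + (μ + 1)) = G
  by_cases hG : G = 0
  · simp [hG]
  field_simp

lemma summable_besselE {μ : ℝ} (hμ : 0 ≤ μ) (u : ℝ) :
    Summable fun k : ℕ => besselECoeff μ k * u ^ k := by
  refine Summable.of_norm_bounded
    ((Real.summable_pow_div_factorial |u|).mul_left (Real.Gamma (1 + μ))⁻¹) fun k => ?_
  rw [Real.norm_eq_abs, abs_mul, abs_pow]
  calc _ ≤ (Real.Gamma (1 + μ))⁻¹ / (Nat.factorial k : ℝ) * |u| ^ k := by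
        gcongr; exact abs_besselECoeff_le hμ k
    _ = _ := by ring

lemma hasDerivAt_besselE {μ : ℝ} (hμ : 0 ≤ μ) (u : ℝ) :
    HasDerivAt (besselE μ) (-besselE (μ + 1) u) u := by
  have hC : 0 ≤ (Real.Gamma (1 + (μ + 1)))⁻¹ :=
    inv_nonneg.2 (Real.Gamma_pos_of_pos (by linarith)).le
  have key := hasDerivAt_tsum_of_isPreconnected (𝕜 := ℝ)
    (u := fun k : ℕ => (Real.Gamma (1 + (μ + 1)))⁻¹ *
      ((|u| + 1) ^ (k - 1) / (Nat.factorial (k - 1) : ℝ)))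
    (g := fun (k : ℕ) (v : ℝ) => besselECoeff μ k * v ^ k)
    (g' := fun (k : ℕ) (v : ℝ) => besselECoeff μ k * (k * v ^ (k - 1)))
    (t := Metric.ball 0 (|u| + 1)) (y₀ := u) (y := u) ?_ Metric.isOpen_ball
    (convex_ball _ _).isPreconnected
    (fun k v _ => (hasDerivAt_pow k v).const_mul _) ?_ (by simp) (summable_besselE hμ u) (by simp)
  · have e : ∑' k : ℕ, besselECoeff μ k * (k * u ^ (k - 1)) = -besselE (μ + 1) u := by
      have hs : Summable fun k : ℕ => besselECoeff μ (k + 1) * (((k + 1 : ℕ) : ℝ) * u ^ k) := by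
        refine (summable_besselE (by linarith : 0 ≤ μ + 1) u).neg.congr fun k => ?_
        push_cast
        rw [← mul_assoc, besselECoeff_succ, neg_mul]
      rw [((summable_nat_add_iff 1).1 (by simpa using hs)).tsum_eq_zero_add, besselE, ← tsum_neg]
      simp only [Nat.cast_zero, zero_mul, mul_zero, zero_add, Nat.add_sub_cancel]
      refine tsum_congr fun k => ?_
      push_cast
      rw [← mul_assoc, besselECoeff_succ, neg_mul]
    rw [← e]
    exact key
  · refine Summable.mul_left _ ((summable_nat_add_iff 1).1 ?_)
    simpa using Real.summable_pow_div_factorial (|u| + 1)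
  · intro k v hv
    rw [mem_ball_zero_iff, Real.norm_eq_abs] at hv
    rcases k with _ | k
    · simpa using hC
    · simp only [Nat.add_sub_cancel]
      push_cast
      rw [← mul_assoc, besselECoeff_succ, Real.norm_eq_abs, abs_mul, abs_neg, abs_pow]
      calc _ ≤ (Real.Gamma (1 + (μ + 1)))⁻¹ / (Nat.factorial k : ℝ) * (|u| + 1) ^ k := by
            gcongr; exact abs_besselECoeff_le (by linarith) k
        _ = _ := by ring

lemma besselE_recurrence {μ : ℝ} (hμ : 0 ≤ μ) (u : ℝ) :
    besselE μ u = (μ + 1) * besselE (μ + 1) u - u * besselE (μ + 1 + 1) u := by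
  have h1 := (summable_besselE (by linarith : 0 ≤ μ + 1) u)
  have h2 := (summable_besselE (by linarith : 0 ≤ μ + 1 + 1) u)
  have coeff (k : ℕ) : besselECoeff μ k = (μ + 1 + k) * besselECoeff (μ + 1) k := by
    have hpos : (0 : ℝ) < (k : ℝ) + 1 + μ := by positivity
    have hG := (Real.Gamma_pos_of_pos hpos).ne'
    have hf : (Nat.factorial k : ℝ) ≠ 0 := by exact_mod_cast Nat.factorial_ne_zero k
    rw [besselECoeff, besselECoeff, ← add_assoc, Real.Gamma_add_one hpos.ne']
    field_simp
    ring
  have hshift : u * besselE (μ + 1 + 1) u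
      = -∑' k : ℕ, (k : ℝ) * besselECoeff (μ + 1) k * u ^ k := by
    have e : ∀ k : ℕ, ((k + 1 : ℕ) : ℝ) * besselECoeff (μ + 1) (k + 1) * u ^ (k + 1)
        = -(u * (besselECoeff (μ + 1 + 1) k * u ^ k)) := fun k => by
      push_cast
      rw [mul_comm ((k : ℝ) + 1), besselECoeff_succ]
      ring
    rw [((summable_nat_add_iff 1).1 ((h2.mul_left u).neg.congr fun k => (e k).symm)).tsum_eq_zero_add,
      tsum_congr e, tsum_neg, tsum_mul_left, besselE]
    simp
  have h3 : Summable fun k : ℕ => (k : ℝ) * besselECoeff (μ + 1) k * u ^ k := by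
    refine ((summable_besselE hμ u).sub (h1.mul_left (μ + 1))).congr fun k => ?_
    rw [coeff]; ring
  rw [hshift, sub_neg_eq_add, besselE, besselE, ← tsum_mul_left, ← (h1.mul_left (μ + 1)).tsum_add h3]
  refine tsum_congr fun k => ?_
  rw [coeff]; ring

lemma besselJ_eq {ν x : ℝ} (hx : 0 < x) :
    besselJ ν x = (x / 2) ^ ν * besselE ν (x ^ 2 / 4) := by
  rw [besselJ, besselE, ← tsum_mul_left]
  refine tsum_congr fun k => ?_
  have e (a : ℝ) (ha : 0 < a) : a ^ (2 * (k : ℝ) + ν) = (a ^ 2) ^ k * a ^ ν := by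
    rw [Real.rpow_add ha, ← pow_mul, ← Real.rpow_natCast a (2 * k)]
    push_cast
    rfl
  rw [besselECoeff, e x hx, e 2 two_pos, Real.div_rpow hx.le two_pos.le, div_pow]
  norm_num
  ring

lemma mul_deriv_besselJ {ν x : ℝ} (hν : 0 ≤ ν) (hx : 0 < x) :
    x * deriv (besselJ ν) x
      = (x / 2) ^ ν * (ν * besselE ν (x ^ 2 / 4) - x ^ 2 / 2 * besselE (ν + 1) (x ^ 2 / 4)) := by
  have h1 : HasDerivAt (fun y : ℝ => (y / 2) ^ ν) (1 / 2 * ν * (x / 2) ^ (ν - 1)) x :=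
    ((hasDerivAt_id x).div_const 2).rpow_const (Or.inl (by simpa using hx.ne'))
  have h2 : HasDerivAt (fun y : ℝ => y ^ 2 / 4) (x / 2) x := by
    refine ((hasDerivAt_pow 2 x).div_const 4).congr_deriv ?_
    norm_num; ring
  have h3 := h1.mul ((hasDerivAt_besselE hν (x ^ 2 / 4)).comp x h2)
  have h4 : HasDerivAt (besselJ ν) _ x := h3.congr_of_eventuallyEq (by
    filter_upwards [lt_mem_nhds hx] with y hy using besselJ_eq hy)
  rw [h4.deriv, Real.rpow_sub_one (by positivity)]
  simp only [Function.comp]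
  field_simp
  ring

/-- A weighted Hardy-type estimate by Tonelli: a weight `k` with tail integrals bounded by `B`. -/
lemma integral_abs_mul_le_of_tail_le {f f' k B : ℝ → ℝ}
    (hf'int : IntegrableOn f' (Set.Icc 0 1))
    (hf : ∀ x ∈ Set.Icc (0:ℝ) 1, f x = ∫ t in (0:ℝ)..x, f' t)
    (hk : Measurable k) (hk0 : ∀ x ∈ Set.Ioc (0:ℝ) 1, 0 ≤ k x)
    (hB0 : ∀ t ∈ Set.Ioc (0:ℝ) 1, 0 ≤ B t)
    (hB : IntegrableOn (fun t => |f' t| * B t) (Set.Ioc 0 1))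
    (htail : ∀ t ∈ Set.Ioc (0:ℝ) 1,
      ∫⁻ x in Set.Ioc t 1, ENNReal.ofReal (k x) ≤ ENNReal.ofReal (B t)) :
    IntegrableOn (fun x => |f x| * k x) (Set.Ioc 0 1) ∧
      ∫ x in Set.Ioc (0:ℝ) 1, |f x| * k x ≤ ∫ t in Set.Ioc (0:ℝ) 1, |f' t| * B t := by
  have hint : IntegrableOn f' (Set.Ioc 0 1) := hf'int.mono_set Set.Ioc_subset_Icc_self
  have hfcont : ContinuousOn f (Set.Icc 0 1) := by
    have h := intervalIntegral.continuousOn_primitive_interval (a := 0) (b := 1) (f := f')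
      (μ := volume) (by rwa [Set.uIcc_of_le zero_le_one])
    rw [Set.uIcc_of_le zero_le_one] at h
    exact h.congr hf
  have hfm : AEStronglyMeasurable f (volume.restrict (Set.Ioc 0 1)) :=
    (hfcont.mono Set.Ioc_subset_Icc_self).aestronglyMeasurable measurableSet_Ioc
  have hm : AEStronglyMeasurable (fun x => |f x| * k x) (volume.restrict (Set.Ioc 0 1)) :=
    hfm.norm.mul hk.aestronglyMeasurable
  have hnn : 0 ≤ᵐ[volume.restrict (Set.Ioc 0 1)] fun x => |f x| * k x := by
    filter_upwards [ae_restrict_mem measurableSet_Ioc] with x hx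
    exact mul_nonneg (abs_nonneg _) (hk0 x hx)
  have hnnB : 0 ≤ᵐ[volume.restrict (Set.Ioc 0 1)] fun x => |f' x| * B x := by
    filter_upwards [ae_restrict_mem measurableSet_Ioc] with x hx
    exact mul_nonneg (abs_nonneg _) (hB0 x hx)
  have hg : AEMeasurable (fun t => ENNReal.ofReal |f' t|) (volume.restrict (Set.Ioc 0 1)) :=
    hint.aestronglyMeasurable.aemeasurable.abs.ennreal_ofReal
  have hkm : Measurable fun x => ENNReal.ofReal (k x) := hk.ennreal_ofReal
  have hfle : ∀ x ∈ Set.Ioc (0:ℝ) 1, ENNReal.ofReal |f x|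
      ≤ ∫⁻ t in Set.Ioc 0 1, (Set.Iio x).indicator 1 t * ENNReal.ofReal |f' t| := by
    intro x hx
    have hsub : Set.Ioc 0 x ⊆ Set.Ioc (0:ℝ) 1 := Set.Ioc_subset_Ioc_right hx.2
    calc ENNReal.ofReal |f x| ≤ ENNReal.ofReal (∫ t in Set.Ioc 0 x, |f' t|) := by
          apply ENNReal.ofReal_le_ofReal
          rw [hf x ⟨hx.1.le, hx.2⟩, intervalIntegral.integral_of_le hx.1.le]
          exact abs_integral_le_integral_abs
      _ = ∫⁻ t in Set.Ioc 0 x, ENNReal.ofReal |f' t| :=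
          ofReal_integral_eq_lintegral_ofReal (hint.mono_set hsub).abs
            (Eventually.of_forall fun t => abs_nonneg _)
      _ = ∫⁻ t in Set.Ioo 0 x, ENNReal.ofReal |f' t| := setLIntegral_congr Ioo_ae_eq_Ioc.symm
      _ = ∫⁻ t in Set.Ioc 0 1 ∩ Set.Iio x, ENNReal.ofReal |f' t| := by
          congr 2
          ext t
          simp only [Set.mem_Ioo, Set.mem_inter_iff, Set.mem_Ioc, Set.mem_Iio]
          exact ⟨fun h => ⟨⟨h.1, h.2.le.trans hx.2⟩, h.2⟩, fun h => ⟨h.1.1, h.2⟩⟩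
      _ = ∫⁻ t in Set.Ioc 0 1, (Set.Iio x).indicator (fun t => ENNReal.ofReal |f' t|) t := by
          rw [setLIntegral_indicator measurableSet_Iio, Set.inter_comm]
      _ = _ := by
          refine lintegral_congr fun t => ?_
          by_cases h : t ∈ Set.Iio x <;> simp [h]
  have hmeas : AEMeasurable (Function.uncurry fun x t : ℝ =>
      (Set.Iio x).indicator (1 : ℝ → ENNReal) t * ENNReal.ofReal |f' t| * ENNReal.ofReal (k x))
      ((volume.restrict (Set.Ioc 0 1)).prod (volume.restrict (Set.Ioc 0 1))) := by
    refine AEMeasurable.mul (AEMeasurable.mul ?_ hg.comp_snd) (hkm.comp measurable_fst).aemeasurable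
    have : Measurable (({p : ℝ × ℝ | p.2 < p.1}).indicator (1 : ℝ × ℝ → ENNReal)) :=
      measurable_one.indicator (measurableSet_lt measurable_snd measurable_fst)
    exact this.aemeasurable
  have main : ∫⁻ x in Set.Ioc 0 1, ENNReal.ofReal (|f x| * k x)
      ≤ ENNReal.ofReal (∫ t in Set.Ioc (0:ℝ) 1, |f' t| * B t) := by
    calc ∫⁻ x in Set.Ioc 0 1, ENNReal.ofReal (|f x| * k x)
        ≤ ∫⁻ x in Set.Ioc 0 1, ∫⁻ t in Set.Ioc 0 1,
          (Set.Iio x).indicator 1 t * ENNReal.ofReal |f' t| * ENNReal.ofReal (k x) := by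
          refine setLIntegral_mono' measurableSet_Ioc fun x hx => ?_
          rw [lintegral_mul_const' _ _ ENNReal.ofReal_ne_top, ENNReal.ofReal_mul (abs_nonneg _)]
          gcongr
          exact hfle x hx
      _ = ∫⁻ t in Set.Ioc 0 1, ∫⁻ x in Set.Ioc 0 1,
          (Set.Iio x).indicator 1 t * ENNReal.ofReal |f' t| * ENNReal.ofReal (k x) :=
          lintegral_lintegral_swap hmeas
      _ ≤ ∫⁻ t in Set.Ioc 0 1, ENNReal.ofReal (|f' t| * B t) := by
          refine setLIntegral_mono' measurableSet_Ioc fun t ht => ?_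
          have e : ∀ x : ℝ, (Set.Iio x).indicator 1 t * ENNReal.ofReal |f' t| * ENNReal.ofReal (k x)
              = ENNReal.ofReal |f' t| * (Set.Ioi t).indicator (fun x => ENNReal.ofReal (k x)) x := by
            intro x
            by_cases h : t < x <;> simp [h]
          have hset : Set.Ioi t ∩ Set.Ioc 0 1 = Set.Ioc t 1 := by
            ext x
            simp only [Set.mem_inter_iff, Set.mem_Ioc, Set.mem_Ioi]
            exact ⟨fun h => ⟨h.1, h.2.2⟩, fun h => ⟨h.1, ht.1.trans h.1, h.2⟩⟩
          rw [lintegral_congr e, lintegral_const_mul' _ _ ENNReal.ofReal_ne_top,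
            setLIntegral_indicator measurableSet_Ioi, hset, ENNReal.ofReal_mul (abs_nonneg _)]
          gcongr
          exact htail t ht
      _ = _ := (ofReal_integral_eq_lintegral_ofReal hB hnnB).symm
  refine ⟨⟨hm, ?_⟩, ?_⟩
  · rw [hasFiniteIntegral_iff_ofReal hnn]
    exact main.trans_lt ENNReal.ofReal_lt_top
  · rw [integral_eq_lintegral_of_nonneg_ae hnn hm]
    exact ENNReal.toReal_le_of_le_ofReal (integral_nonneg_of_ae hnnB) main

/-- The logarithmic derivative of `besselE ν`, multiplied by the variable. -/
noncomputable def besselELogDeriv (ν u : ℝ) : ℝ :=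
  -(u * besselE (ν + 1) u) / besselE ν u

/-- The Turán-type expression governing the derivative of `besselELogDeriv ν`. -/
noncomputable def besselETuran (ν u : ℝ) : ℝ :=
  besselE ν u ^ 2 - ν * besselE ν u * besselE (ν + 1) u + u * besselE (ν + 1) u ^ 2

lemma hasDerivAt_besselELogDeriv {ν u : ℝ} (hν : 0 ≤ ν) (hE : besselE ν u ≠ 0) :
    HasDerivAt (besselELogDeriv ν) (-besselETuran ν u / besselE ν u ^ 2) u := by
  have hG := hasDerivAt_besselE hν u
  have hH := hasDerivAt_besselE (by linarith : 0 ≤ ν + 1) u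
  have hrec := besselE_recurrence hν u
  refine (((hasDerivAt_id u).mul hH).neg.div hG hE).congr_deriv ?_
  simp only [besselETuran, id, Pi.mul_apply, Pi.neg_apply]
  congr 1
  linear_combination besselE ν u * hrec

lemma besselETuran_nonneg {ν u : ℝ} (hν : 0 ≤ ν) (hu : 0 < u) : 0 ≤ besselETuran ν u := by
  have hd (v : ℝ) (hv : 0 < v) : HasDerivAt (fun v => v ^ (ν + 1) * besselETuran ν v)
      (v ^ ν * besselE ν v ^ 2) v := by
    have hG := hasDerivAt_besselE hν v
    have hH := hasDerivAt_besselE (by linarith : 0 ≤ ν + 1) v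
    have hrec := besselE_recurrence hν v
    have hQ := ((hG.pow 2).sub ((hG.const_mul ν).mul hH)).add ((hasDerivAt_id v).mul (hH.pow 2))
    refine ((Real.hasDerivAt_rpow_const (p := ν + 1) (Or.inl hv.ne')).mul hQ).congr_deriv ?_
    simp only [id, Pi.mul_apply, Pi.pow_apply, Pi.sub_apply, Pi.add_apply, add_sub_cancel_right,
      Real.rpow_add_one hv.ne', Nat.cast_ofNat, Nat.add_one_sub_one, pow_one]
    linear_combination v ^ ν * (ν * besselE ν v - 2 * v * besselE (ν + 1) v) * hrec
  have hcE (μ : ℝ) (hμ : 0 ≤ μ) : Continuous (besselE μ) :=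
    continuous_iff_continuousAt.2 fun v => (hasDerivAt_besselE hμ v).continuousAt
  have hc : Continuous fun v => v ^ (ν + 1) * besselETuran ν v := by
    have h0 := hcE ν hν
    have h1 := hcE (ν + 1) (by linarith)
    unfold besselETuran
    exact (Real.continuous_rpow_const (by linarith)).mul (by fun_prop)
  have hmono : MonotoneOn (fun v => v ^ (ν + 1) * besselETuran ν v) (Set.Ici 0) := by
    refine monotoneOn_of_deriv_nonneg (convex_Ici 0) hc.continuousOn ?_ ?_ <;>
      simp only [interior_Ici]
    · exact fun v hv => (hd v hv).differentiableAt.differentiableWithinAt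
    · intro v hv
      rw [(hd v hv).deriv]
      have := Real.rpow_nonneg (le_of_lt hv) ν
      positivity
  have h := hmono (Set.mem_Ici.2 le_rfl) (Set.mem_Ici.2 hu.le) hu.le
  simp only [Real.zero_rpow (by linarith : ν + 1 ≠ 0), zero_mul] at h
  exact nonneg_of_mul_nonneg_right h (Real.rpow_pos_of_pos hu _)

lemma antitoneOn_besselELogDeriv {ν b : ℝ} (hν : 0 ≤ ν)
    (hE : ∀ u ∈ Set.Icc 0 b, besselE ν u ≠ 0) :
    AntitoneOn (besselELogDeriv ν) (Set.Icc 0 b) := by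
  refine antitoneOn_of_deriv_nonpos (convex_Icc 0 b)
    (fun u hu => (hasDerivAt_besselELogDeriv hν (hE u hu)).continuousAt.continuousWithinAt)
    ?_ ?_ <;> intro u hu <;> have hu' := interior_subset hu <;> rw [interior_Icc] at hu
  · exact (hasDerivAt_besselELogDeriv hν (hE u hu')).differentiableAt.differentiableWithinAt
  · rw [(hasDerivAt_besselELogDeriv hν (hE u hu')).deriv]
    exact div_nonpos_of_nonpos_of_nonneg (neg_nonpos.2 (besselETuran_nonneg hν hu.1))
      (sq_nonneg _)

lemma besselELogDeriv_zero (ν : ℝ) : besselELogDeriv ν 0 = 0 := by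
  simp [besselELogDeriv]

/-- The Riccati equation of the logarithmic derivative. -/
lemma mul_deriv_besselELogDeriv {ν u : ℝ} (hE : besselE ν u ≠ 0) :
    u * (-besselETuran ν u / besselE ν u ^ 2)
      = -(ν * besselELogDeriv ν u + u + besselELogDeriv ν u ^ 2) := by
  rw [besselETuran, besselELogDeriv]
  field_simp
  ring

lemma besselE_zero_pos {ν : ℝ} (hν : 0 ≤ ν) : 0 < besselE ν 0 := by
  rw [besselE, tsum_eq_single 0 (fun k hk => by simp [hk])]
  have := Real.Gamma_pos_of_pos (by linarith : 0 < 1 + ν)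
  simpa [besselECoeff] using this

/-- Tail bound for the weight `A / x ^ 2 + c ^ 2 * x ^ (m - 2)`, obtained by comparing with the
logarithmic derivative `(y + m * h(c ^ 2 / m ^ 2 * x ^ m)) / x` of the Bessel solution. -/
lemma integral_bessel_weight_le {m ν lam c : ℝ} (hm : 0 < m) (hν : 0 ≤ ν) (hlam : 0 ≤ lam)
    (hE : ∀ u ∈ Set.Icc 0 (c ^ 2 / m ^ 2), besselE ν u ≠ 0)
    (hroot : lam = (1 + ν * m) / 2 + m * besselELogDeriv ν (c ^ 2 / m ^ 2))
    {t : ℝ} (ht : t ∈ Set.Ioc (0:ℝ) 1) :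
    ∫ x in t..1, ((1 - ν ^ 2 * m ^ 2) / 4 * x ^ (-2 : ℝ) + c ^ 2 * x ^ (m - 2))
      ≤ ((1 + ν * m) / 2 - lam ^ 2) / t + (lam ^ 2 - lam) := by
  set b := c ^ 2 / m ^ 2 with hb
  set y := (1 + ν * m) / 2 with hy
  set k : ℝ → ℝ := fun x => (1 - ν ^ 2 * m ^ 2) / 4 * x ^ (-2 : ℝ) + c ^ 2 * x ^ (m - 2) with hk
  set p : ℝ → ℝ := fun x => y + m * besselELogDeriv ν (b * x ^ m) with hp
  have hb0 : 0 ≤ b := by positivity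
  have hmem (x : ℝ) (hx : x ∈ Set.Ioc (0:ℝ) 1) : b * x ^ m ∈ Set.Icc 0 b :=
    ⟨mul_nonneg hb0 (Real.rpow_nonneg hx.1.le _),
      mul_le_of_le_one_right hb0 (Real.rpow_le_one hx.1.le hx.2 hm.le)⟩
  have hanti := antitoneOn_besselELogDeriv hν hE
  have hp_ge (x : ℝ) (hx : x ∈ Set.Ioc (0:ℝ) 1) : lam ≤ p x := by
    have := hanti (hmem x hx) (Set.right_mem_Icc.2 hb0) (hmem x hx).2
    rw [hroot]
    simp only [hp]
    gcongr
  have hp_le (x : ℝ) (hx : x ∈ Set.Ioc (0:ℝ) 1) : p x ≤ y := by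
    have := hanti (Set.left_mem_Icc.2 hb0) (hmem x hx) (hmem x hx).1
    rw [besselELogDeriv_zero] at this
    simp only [hp]
    nlinarith
  have hp1 : p 1 = lam := by simp [hp, hroot]
  have hw (x : ℝ) (hx : x ∈ Set.Ioc (0:ℝ) 1) :
      HasDerivAt (fun x => p x / x) (-(k x + p x ^ 2 / x ^ 2)) x := by
    have hE' := hE _ (hmem x hx)
    have hx0 : x ≠ 0 := hx.1.ne'
    have h1 : HasDerivAt (fun x => b * x ^ m) (b * (m * x ^ (m - 1))) x :=
      (Real.hasDerivAt_rpow_const (Or.inl hx0)).const_mul b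
    have h2 := (((hasDerivAt_besselELogDeriv hν hE').comp x h1).const_mul m).const_add y
    have hric := mul_deriv_besselELogDeriv hE'
    refine (h2.div (hasDerivAt_id x) hx0).congr_deriv ?_
    simp only [hk, hp, Function.comp, id]
    rw [Real.rpow_sub_one hx0, Real.rpow_sub hx.1, Real.rpow_neg hx.1.le, Real.rpow_two]
    set q := -besselETuran ν (b * x ^ m) / besselE ν (b * x ^ m) ^ 2
    set h := besselELogDeriv ν (b * x ^ m)
    have hbm : c ^ 2 = b * m ^ 2 := by rw [hb]; field_simp
    rw [hbm, hy]
    field_simp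
    linear_combination 16 * m ^ 2 * hric
  have hkc : ContinuousOn k (Set.Ioi 0) := by
    intro x hx
    have hx0 : x ≠ 0 := (Set.mem_Ioi.1 hx).ne'
    exact ((continuousAt_const.mul (Real.continuousAt_rpow_const _ _ (Or.inl hx0))).add
      (continuousAt_const.mul
        (Real.continuousAt_rpow_const _ _ (Or.inl hx0)))).continuousWithinAt
  have hsub : Set.uIcc t 1 ⊆ Set.Ioi 0 := by
    rw [Set.uIcc_of_le ht.2]
    exact fun x hx => ht.1.trans_le hx.1
  have hkint : IntervalIntegrable k volume t 1 := (hkc.mono hsub).intervalIntegrable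
  have hqc : ContinuousOn (fun x : ℝ => lam ^ 2 / x ^ 2) (Set.uIcc t 1) := by
    refine continuousOn_const.div (by fun_prop) fun x hx => ?_
    have : 0 < x := hsub hx
    positivity
  have hqint := hqc.intervalIntegrable (μ := volume)
  have hinv : ∫ x in t..1, lam ^ 2 / x ^ 2 = lam ^ 2 / t - lam ^ 2 := by
    have := intervalIntegral.integral_eq_sub_of_hasDerivAt (a := t) (b := 1)
      (f := fun x : ℝ => -lam ^ 2 / x) (f' := fun x => lam ^ 2 / x ^ 2) (fun x hx => ?_) hqint
    · rw [this]; ring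
    · have hx0 : x ≠ 0 := (Set.mem_Ioi.1 (hsub hx)).ne'
      refine ((hasDerivAt_const x (-lam ^ 2)).div (hasDerivAt_id x) hx0).congr_deriv ?_
      simp
  have hIcc {x : ℝ} (hx : x ∈ Set.uIcc t 1) : x ∈ Set.Ioc (0:ℝ) 1 :=
    ⟨hsub hx, by rw [Set.uIcc_of_le ht.2] at hx; exact hx.2⟩
  have hpc : ContinuousOn (fun x => k x + p x ^ 2 / x ^ 2) (Set.uIcc t 1) := by
    refine (hkc.mono hsub).add ?_
    have h1 : ContinuousOn (fun x => p x / x) (Set.uIcc t 1) := fun x hx =>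
      (hw x (hIcc hx)).continuousAt.continuousWithinAt
    exact (h1.pow 2).congr fun x _ => by simp [div_pow]
  have hFTC : ∫ x in t..1, (k x + p x ^ 2 / x ^ 2) = p t / t - lam := by
    have := intervalIntegral.integral_eq_sub_of_hasDerivAt (fun x hx => hw x (hIcc hx))
      hpc.neg.intervalIntegrable
    rw [intervalIntegral.integral_neg, hp1] at this
    linarith
  have hle : ∫ x in t..1, (k x + lam ^ 2 / x ^ 2) ≤ ∫ x in t..1, (k x + p x ^ 2 / x ^ 2) := by
    refine intervalIntegral.integral_mono_on ht.2 (hkint.add hqint) hpc.intervalIntegrable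
      fun x hx => ?_
    have := hp_ge x ⟨ht.1.trans_le hx.1, hx.2⟩
    gcongr
  rw [intervalIntegral.integral_add hkint hqint, hinv, hFTC] at hle
  have hpt : p t / t ≤ y / t := div_le_div_of_nonneg_right (hp_le t ht) ht.1.le
  rw [sub_div]
  linarith

theorem stmt_2 (m ν lam c jν : ℝ) (f f' : ℝ → ℝ)
    (hm : 0 < m) (hν : ν ∈ Set.Ioc 0 (1 / m))
    (hlam : lam ∈ Set.Ico 0 ((1 + ν * m) / 2))
    (hc : 0 < c)
    (hjν_pos : 0 < jν) (hjν_zero : besselJ ν jν = 0)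
    (hjν_first : ∀ t ∈ Set.Ioo 0 jν, 0 < besselJ ν t)
    (hcm : 2 * c / m ∈ Set.Ioo 0 jν)
    (hroot : (1 - 2 * lam) * besselJ ν (2 * c / m)
      + 2 * c * deriv (besselJ ν) (2 * c / m) = 0)
    (hf'int : IntegrableOn f' (Set.Icc 0 1))
    (hf : ∀ x ∈ Set.Icc (0:ℝ) 1, f x = ∫ t in (0:ℝ)..x, f' t)
    (hL1 : IntegrableOn (fun x => f' x / x) (Set.Ioc 0 1)) :
    (1 - ν ^ 2 * m ^ 2) / 4 * (∫ x in Set.Ioc (0:ℝ) 1, |f x| / x ^ 2)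
      + c ^ 2 * (∫ x in Set.Ioc (0:ℝ) 1, |f x| / x ^ ((2:ℝ) - m))
    ≤ ((1 + ν * m) / 2 - lam ^ 2) * (∫ x in Set.Ioc (0:ℝ) 1, |f' x| / x)
      + (lam ^ 2 - lam) * (∫ x in Set.Ioc (0:ℝ) 1, |f' x|) := by
  have hν0 : 0 ≤ ν := hν.1.le
  have hνm : ν * m ≤ 1 := (le_div_iff₀ hm).1 hν.2
  have hνm0 : 0 ≤ ν * m := mul_nonneg hν0 hm.le
  have hA : 0 ≤ (1 - ν ^ 2 * m ^ 2) / 4 := by nlinarith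
  have hE : ∀ u ∈ Set.Icc 0 (c ^ 2 / m ^ 2), besselE ν u ≠ 0 := by
    intro u hu
    rcases hu.1.eq_or_lt with rfl | hu0
    · exact (besselE_zero_pos hν0).ne'
    have hs : 0 < 2 * √u := by positivity
    have hsle : 2 * √u ≤ 2 * c / m := by
      have : √u ≤ c / m := Real.sqrt_le_iff.2 ⟨by positivity, by rw [div_pow]; exact hu.2⟩
      calc 2 * √u ≤ 2 * (c / m) := by gcongr
        _ = _ := by ring
    have hJ := hjν_first _ ⟨hs, hsle.trans_lt hcm.2⟩
    rw [besselJ_eq hs, mul_pow, Real.sq_sqrt hu0.le] at hJ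
    norm_num at hJ
    intro h0
    simp [h0] at hJ
  have hlog : lam = (1 + ν * m) / 2 + m * besselELogDeriv ν (c ^ 2 / m ^ 2) := by
    have hz := hcm.1
    have hd := mul_deriv_besselJ hν0 hz
    have hpow := Real.rpow_pos_of_pos (by positivity : 0 < 2 * c / m / 2) ν
    have e1 : (2 * c / m) ^ 2 / 4 = c ^ 2 / m ^ 2 := by ring
    have e2 : (2 * c / m) ^ 2 / 2 = 2 * (c ^ 2 / m ^ 2) := by ring
    have e3 : 2 * c * deriv (besselJ ν) (2 * c / m)
        = m * (2 * c / m * deriv (besselJ ν) (2 * c / m)) := by field_simp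
    have hG := hE _ (Set.right_mem_Icc.2 (by positivity))
    rw [e3, hd, besselJ_eq hz, e1, e2] at hroot
    rw [besselELogDeriv]
    set b := c ^ 2 / m ^ 2
    have h0 : (1 - 2 * lam) * besselE ν b
        + m * (ν * besselE ν b - 2 * b * besselE (ν + 1) b) = 0 := by
      refine (mul_eq_zero.1 ?_).resolve_left hpow.ne'
      linear_combination hroot
    field_simp
    linear_combination -h0
  have hg : IntegrableOn f' (Set.Ioc 0 1) := hf'int.mono_set Set.Ioc_subset_Icc_self
  have hgdiv : IntegrableOn (fun t => |f' t| / t) (Set.Ioc 0 1) :=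
    IntegrableOn.congr_fun hL1.abs (fun t ht => by simp [abs_div, abs_of_pos ht.1]) measurableSet_Ioc
  have hofReal (w : ℝ → ℝ) (hw : ContinuousOn w (Set.Ioi 0)) (hw0 : ∀ x ∈ Set.Ioi (0:ℝ), 0 ≤ w x)
      (t : ℝ) (ht : t ∈ Set.Ioc (0:ℝ) 1) :
      ∫⁻ x in Set.Ioc t 1, ENNReal.ofReal (w x) = ENNReal.ofReal (∫ x in t..1, w x) := by
    rw [intervalIntegral.integral_of_le ht.2]
    refine (ofReal_integral_eq_lintegral_ofReal ?_ ?_).symm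
    · refine ((hw.mono fun x hx => ?_).integrableOn_Icc).mono_set Set.Ioc_subset_Icc_self
      exact ht.1.trans_le hx.1
    · filter_upwards [ae_restrict_mem measurableSet_Ioc] with x hx
      exact hw0 x (ht.1.trans hx.1)
  have hrpow (r : ℝ) : ContinuousOn (fun x : ℝ => x ^ r) (Set.Ioi 0) := fun x hx =>
    (Real.continuousAt_rpow_const _ _ (Or.inl (Set.mem_Ioi.1 hx).ne')).continuousWithinAt
  have hrpowm (r : ℝ) : Measurable (fun x : ℝ => x ^ r) := by fun_prop
  have hI1 : IntegrableOn (fun x => |f x| * x ^ (-2 : ℝ)) (Set.Ioc 0 1) := by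
    refine (integral_abs_mul_le_of_tail_le (B := fun t => 1 / t) hf'int hf (hrpowm _)
      (fun x hx => Real.rpow_nonneg hx.1.le _) (fun t ht => one_div_nonneg.2 ht.1.le)
      (by simpa only [mul_one_div] using hgdiv) fun t ht => ?_).1
    rw [hofReal _ (hrpow _) (fun x hx => Real.rpow_nonneg (le_of_lt hx) _) t ht]
    apply ENNReal.ofReal_le_ofReal
    rw [integral_rpow (Or.inr ⟨by norm_num, by
      rw [Set.uIcc_of_le ht.2]; exact fun h => absurd h.1 (not_le.2 ht.1)⟩)]
    norm_num [Real.rpow_neg_one, div_neg]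
  have hfm : AEStronglyMeasurable (fun x => |f x| * x ^ (m - 2))
      (volume.restrict (Set.Ioc 0 1)) := by
    refine (hI1.aestronglyMeasurable.mul (hrpowm m).aestronglyMeasurable).congr ?_
    filter_upwards [ae_restrict_mem measurableSet_Ioc] with x hx
    simp only [Pi.mul_apply]
    rw [mul_assoc, ← Real.rpow_add hx.1]
    ring_nf
  have hI2 : IntegrableOn (fun x => |f x| * x ^ (m - 2)) (Set.Ioc 0 1) := by
    refine hI1.mono' hfm ?_
    filter_upwards [ae_restrict_mem measurableSet_Ioc] with x hx
    rw [Real.norm_of_nonneg (mul_nonneg (abs_nonneg _) (Real.rpow_nonneg hx.1.le _))]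
    refine mul_le_mul_of_nonneg_left ?_ (abs_nonneg _)
    exact Real.rpow_le_rpow_of_exponent_ge hx.1 hx.2 (by linarith)
  have hB (t : ℝ) (ht : t ∈ Set.Ioc (0:ℝ) 1) :=
    integral_bessel_weight_le hm hν0 hlam.1 hE hlog ht
  have hk0 (x : ℝ) (hx : 0 < x) :
      0 ≤ (1 - ν ^ 2 * m ^ 2) / 4 * x ^ (-2 : ℝ) + c ^ 2 * x ^ (m - 2) := by
    have := Real.rpow_nonneg hx.le (-2)
    have := Real.rpow_nonneg hx.le (m - 2)
    positivity
  have hBeq : (fun t => |f' t| * (((1 + ν * m) / 2 - lam ^ 2) / t + (lam ^ 2 - lam)))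
      = fun t => ((1 + ν * m) / 2 - lam ^ 2) * (|f' t| / t) + (lam ^ 2 - lam) * |f' t| := by
    funext t; ring
  have hBint := (hgdiv.const_mul ((1 + ν * m) / 2 - lam ^ 2)).add
    (hg.abs.const_mul (lam ^ 2 - lam))
  have main := (integral_abs_mul_le_of_tail_le hf'int hf
    (k := fun x => (1 - ν ^ 2 * m ^ 2) / 4 * x ^ (-2 : ℝ) + c ^ 2 * x ^ (m - 2))
    (B := fun t => ((1 + ν * m) / 2 - lam ^ 2) / t + (lam ^ 2 - lam))
    (((hrpowm _).const_mul _).add ((hrpowm _).const_mul _)) (fun x hx => hk0 x hx.1)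
    (fun t ht => (intervalIntegral.integral_nonneg ht.2
      fun x hx => hk0 x (ht.1.trans_le hx.1)).trans (hB t ht))
    (by rw [hBeq]; exact hBint)
    (fun t ht => by
      rw [hofReal (fun x => (1 - ν ^ 2 * m ^ 2) / 4 * x ^ (-2 : ℝ) + c ^ 2 * x ^ (m - 2))
        (((hrpow _).const_mul _).add ((hrpow _).const_mul _)) (fun x hx => hk0 x hx) t ht]
      exact ENNReal.ofReal_le_ofReal (hB t ht))).2
  have hL1eq : ∫ x in Set.Ioc (0:ℝ) 1, |f x| / x ^ 2
      = ∫ x in Set.Ioc (0:ℝ) 1, |f x| * x ^ (-2 : ℝ) :=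
    setIntegral_congr_fun measurableSet_Ioc fun x hx => by
      simp only [Real.rpow_neg hx.1.le, Real.rpow_two, div_eq_mul_inv]
  have hL2eq : ∫ x in Set.Ioc (0:ℝ) 1, |f x| / x ^ ((2:ℝ) - m)
      = ∫ x in Set.Ioc (0:ℝ) 1, |f x| * x ^ (m - 2) :=
    setIntegral_congr_fun measurableSet_Ioc fun x hx => by
      simp only [← neg_sub 2 m, Real.rpow_neg hx.1.le, div_eq_mul_inv]
  rw [hL1eq, hL2eq, ← integral_const_mul, ← integral_const_mul, ← integral_const_mul,
    ← integral_const_mul, ← integral_add (hI1.const_mul _) (hI2.const_mul _),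
    ← integral_add (hgdiv.const_mul _) (hg.abs.const_mul _)]
  rw [hBeq] at main
  refine le_trans (le_of_eq ?_) main
  congr 1
  funext x
  ring
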